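/- arXiv:1304.4481 — 2 statements merged into one kernel-verified Lean document; each statement's English description precedes it below -/
import Mathlib

section
/- Let R be a ring and S a definable subcategory of left R-modules. Let Q be the class of right R-modules isomorphic to a pure submodule of a direct product of character modules of members of S. Then Q is a definable subcategory of right R-modules, and for every left R-module M one has M ∈ S if and only if M* ∈ Q. -/
universe u

open MulOpposite DirectSum

noncomputable section

/-- The additive group `ℚ/ℤ`. -/
abbrev RatCircle : Type := AddCircle (1 : ℚ)

/-- The character group `Hom_ℤ(M, ℚ/ℤ)` of an abelian group `M`. -/
def Character (M : Type u) [AddCommGroup M] : Type u := M →+ RatCircle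

namespace Character

instance instAddCommGroup (M : Type u) [AddCommGroup M] : AddCommGroup (Character M) :=
  inferInstanceAs (AddCommGroup (M →+ RatCircle))

instance instFunLike (M : Type u) [AddCommGroup M] : FunLike (Character M) M RatCircle :=
  inferInstanceAs (FunLike (M →+ RatCircle) M RatCircle)

instance instAddMonoidHomClass (M : Type u) [AddCommGroup M] :
    AddMonoidHomClass (Character M) M RatCircle :=
  inferInstanceAs (AddMonoidHomClass (M →+ RatCircle) M RatCircle)

@[ext] lemma ext {M : Type u} [AddCommGroup M] {f g : Character M}
    (h : ∀ m, f m = g m) : f = g := DFunLike.ext _ _ h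

variable {R : Type u} [Ring R]

/-- If `M` is a left `R`-module then `Character M` is a right `R`-module,
via `(f • r) m = f (r • m)`. -/
instance instSMulRight {M : Type u} [AddCommGroup M] [Module R M] :
    SMul Rᵐᵒᵖ (Character M) where
  smul r f :=
    ((f : M →+ RatCircle).comp (DistribMulAction.toAddMonoidHom M r.unop) : M →+ RatCircle)

lemma smul_right_apply {M : Type u} [AddCommGroup M] [Module R M]
    (r : Rᵐᵒᵖ) (f : Character M) (m : M) : (r • f) m = f (r.unop • m) := rfl

instance moduleRight {M : Type u} [AddCommGroup M] [Module R M] :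
    Module Rᵐᵒᵖ (Character M) where
  one_smul f := ext fun m => by rw [smul_right_apply, unop_one, one_smul]
  mul_smul r s f := ext fun m => by
    rw [smul_right_apply, smul_right_apply, smul_right_apply, unop_mul, mul_smul]
  smul_zero r := ext fun m => rfl
  smul_add r f g := ext fun m => rfl
  add_smul r s f := ext fun m => by
    show f ((r + s).unop • m) = f (r.unop • m) + f (s.unop • m)
    rw [unop_add, add_smul, map_add]
  zero_smul f := ext fun m => by
    show f ((0 : Rᵐᵒᵖ).unop • m) = 0
    rw [unop_zero, zero_smul, map_zero]

/-- If `M` is a right `R`-module then `Character M` is a left `R`-module,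
via `(r • f) m = f (m • r)`. -/
instance instSMulLeft {M : Type u} [AddCommGroup M] [Module Rᵐᵒᵖ M] :
    SMul R (Character M) where
  smul r f :=
    ((f : M →+ RatCircle).comp (DistribMulAction.toAddMonoidHom M (op r)) : M →+ RatCircle)

lemma smul_left_apply {M : Type u} [AddCommGroup M] [Module Rᵐᵒᵖ M]
    (r : R) (f : Character M) (m : M) : (r • f) m = f (op r • m) := rfl

instance moduleLeft {M : Type u} [AddCommGroup M] [Module Rᵐᵒᵖ M] :
    Module R (Character M) where
  one_smul f := ext fun m => by rw [smul_left_apply, op_one, one_smul]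
  mul_smul r s f := ext fun m => by
    rw [smul_left_apply, smul_left_apply, smul_left_apply, op_mul, mul_smul]
  smul_zero r := ext fun m => rfl
  smul_add r f g := ext fun m => rfl
  add_smul r s f := ext fun m => by
    show f (op (r + s) • m) = f (op r • m) + f (op s • m)
    rw [op_add, add_smul, map_add]
  zero_smul f := ext fun m => by
    show f (op (0 : R) • m) = 0
    rw [op_zero, zero_smul, map_zero]

end Character

section Defs

variable (A : Type u) [Ring A]

/-- A pure embedding: an injective linear map such that every finite system of
linear equations with constants in `L` solvable in `M` is solvable in `L`. -/
def IsPureEmbedding {L M : Type u} [AddCommGroup L] [AddCommGroup M]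
    [Module A L] [Module A M] (i : L →ₗ[A] M) : Prop :=
  Function.Injective i ∧
    ∀ (m n : ℕ) (r : Matrix (Fin m) (Fin n) A) (l : Fin m → L),
      (∃ x : Fin n → M, ∀ j, (∑ k, r j k • x k) = i (l j)) →
      ∃ y : Fin n → L, ∀ j, (∑ k, r j k • y k) = l j

/-- A module is pure-injective if every pure embedding out of it splits. -/
def IsPureInjective (N : Type u) [AddCommGroup N] [Module A N] : Prop :=
  ∀ (M : Type u) [AddCommGroup M] [Module A M] (i : N →ₗ[A] M),
    IsPureEmbedding A i → ∃ π : M →ₗ[A] N, π.comp i = LinearMap.id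

/-- `N` is (isomorphic to) a direct summand of `N'`. -/
def IsDirectSummand (N N' : Type u) [AddCommGroup N] [AddCommGroup N']
    [Module A N] [Module A N'] : Prop :=
  ∃ (i : N →ₗ[A] N') (π : N' →ₗ[A] N), π.comp i = LinearMap.id

/-- A module is indecomposable if it is nonzero and is not the internal direct sum
of two nonzero submodules. -/
def IsIndecomposable (N : Type u) [AddCommGroup N] [Module A N] : Prop :=
  (∃ x : N, x ≠ 0) ∧ ∀ U V : Submodule A N, U ≠ ⊥ → V ≠ ⊥ → ¬ IsCompl U V

/-- An injective module: every linear map from a submodule of a module `B` into `E`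
extends to `B`. -/
def IsInjectiveModule (E : Type u) [AddCommGroup E] [Module A E] : Prop :=
  ∀ (B : Type u) [AddCommGroup B] [Module A B] (L : Submodule A B) (g : L →ₗ[A] E),
    ∃ h : B →ₗ[A] E, ∀ x : L, h x = g x

/-- A cogenerator: points of any module are separated by maps into `E`. -/
def IsCogenerator (E : Type u) [AddCommGroup E] [Module A E] : Prop :=
  ∀ (X : Type u) [AddCommGroup X] [Module A X] (x : X), x ≠ 0 →
    ∃ g : X →ₗ[A] E, g x ≠ 0

/-- A class of modules is closed under (arbitrary) direct products. -/
def ProdClosed (C : ModuleCat.{u} A → Prop) : Prop :=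
  ∀ (ι : Type u) (f : ι → ModuleCat.{u} A), (∀ i, C (f i)) →
    C (ModuleCat.of A (∀ i, (f i : Type u)))

/-- A class of modules is closed under modules purely embedding into its members. -/
def PureSubClosed (C : ModuleCat.{u} A → Prop) : Prop :=
  ∀ (N M : ModuleCat.{u} A) (i : N →ₗ[A] M), IsPureEmbedding A i → C M → C N

/-- A class of modules is closed under colimits of directed systems. -/
def DirLimClosed (C : ModuleCat.{u} A → Prop) : Prop :=
  ∀ (ι : Type u) [Preorder ι] [IsDirected ι (· ≤ ·)] [Nonempty ι] [DecidableEq ι]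
    (G : ι → Type u) [∀ i, AddCommGroup (G i)] [∀ i, Module A (G i)]
    (f : ∀ i j, i ≤ j → G i →ₗ[A] G j) [DirectedSystem G (fun i j h => f i j h)],
    (∀ i, C (ModuleCat.of A (G i))) → C (ModuleCat.of A (Module.DirectLimit G f))

/-- A definable subcategory: a class of modules (closed under isomorphism) which is closed
under direct products, colimits of directed systems, and pure submodules. -/
def IsDefinable (C : ModuleCat.{u} A → Prop) : Prop :=
  ProdClosed A C ∧ DirLimClosed A C ∧ PureSubClosed A C

end Defs


/-- The class of right `R`-modules isomorphic to a pure submodule of a product of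
character modules of members of `S`. -/
def Qclass {R : Type u} [Ring R] (S : ModuleCat.{u} R → Prop) :
    ModuleCat.{u} Rᵐᵒᵖ → Prop :=
  fun N => ∃ (ι : Type u) (A : ι → ModuleCat.{u} R),
    (∀ i, S (A i)) ∧
    ∃ emb : (N : Type u) →ₗ[Rᵐᵒᵖ] (∀ i, Character (A i : Type u)),
      IsPureEmbedding Rᵐᵒᵖ emb

namespace Character

lemma sum_apply {M : Type u} [AddCommGroup M] {ι : Type*} (s : Finset ι)
    (f : ι → Character M) (m : M) : (∑ i ∈ s, f i) m = ∑ i ∈ s, f i m :=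
  map_sum (AddMonoidHom.mk' (fun g : Character M => g m) fun _ _ => rfl) f s

/-- `ℚ/ℤ` is injective: a homomorphism vanishing on the kernel of `h` factors through `h`. -/
lemma exists_factor {B C : Type u} [AddCommGroup B] [AddCommGroup C] (h : B →+ C)
    (g : Character B) (hg : ∀ b, h b = 0 → g b = 0) :
    ∃ g' : Character C, ∀ b, g' (h b) = g b := by
  have hinj : Function.Injective (QuotientAddGroup.kerLift h).toIntLinearMap :=
    QuotientAddGroup.kerLift_injective h
  obtain ⟨g', hg'⟩ := CharacterModule.dual_surjective_of_injective _ hinj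
    (QuotientAddGroup.lift h.ker (g : B →+ RatCircle) fun b hb => hg b hb)
  refine ⟨g', fun b => ?_⟩
  exact DFunLike.congr_fun hg' (QuotientAddGroup.mk b)

lemma exists_apply_ne_zero {B C : Type u} [AddCommGroup B] [AddCommGroup C] (h : B →+ C) (c : C)
    (hc : c ∉ h.range) : ∃ g : Character C, (∀ b, g (h b) = 0) ∧ g c ≠ 0 := by
  obtain ⟨g, hg⟩ := CharacterModule.exists_character_apply_ne_zero_of_ne_zero
    (a := (QuotientAddGroup.mk c : C ⧸ h.range))
    (fun h0 => hc ((QuotientAddGroup.eq_zero_iff c).1 h0))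
  refine ⟨AddMonoidHom.comp (g : (C ⧸ h.range) →+ RatCircle) (QuotientAddGroup.mk' h.range),
    fun b => ?_, hg⟩
  have : (QuotientAddGroup.mk (h b) : C ⧸ h.range) = 0 :=
    (QuotientAddGroup.eq_zero_iff _).2 ⟨b, rfl⟩
  exact (congrArg (fun q => g q) this).trans (map_zero g)

/-- The homomorphism `M^J → N^K` given by a matrix of homomorphisms. -/
def matrixHom {M N : Type u} [AddCommGroup M] [AddCommGroup N] {J K : Type u} [Fintype J]
    (φ : J → K → M →+ N) : (J → M) →+ (K → N) where
  toFun v k := ∑ j, φ j k (v j)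
  map_zero' := by ext; simp
  map_add' v w := by ext; simp [Finset.sum_add_distrib]

/-- Solvability of a linear system in a character group, tested on the original group. -/
lemma exists_solution {N : Type u} [AddCommGroup N] {J K : Type u} [Fintype J] [Fintype K]
    (φ : J → K → N →+ N) (f : J → Character N)
    (H : ∀ v : J → N, (∀ k, ∑ j, φ j k (v j) = 0) → ∑ j, f j (v j) = 0) :
    ∃ y : K → Character N, ∀ j x, ∑ k, y k (φ j k x) = f j x := by
  classical
  let g : (J → N) →+ RatCircle :=
    { toFun := fun v => ∑ j, f j (v j)
      map_zero' := by simp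
      map_add' := fun v w => by simp [Finset.sum_add_distrib] }
  obtain ⟨g', hg'⟩ := exists_factor (matrixHom φ) g
    (fun v hv => H v fun k => congrFun hv k)
  refine ⟨fun k => AddMonoidHom.comp (g' : (K → N) →+ RatCircle) (AddMonoidHom.single (fun _ : K => N) k),
    fun j x => ?_⟩
  have h1 : g (Pi.single j x) = f j x := by
    show ∑ j', f j' ((Pi.single j x : J → N) j') = f j x
    rw [Finset.sum_eq_single j]
    · simp
    · intro b _ hb; simp [Pi.single_eq_of_ne hb]
    · simp
  have h2 : matrixHom φ (Pi.single j x) = ∑ k, Pi.single k (φ j k x) := by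
    rw [Finset.univ_sum_single (fun k => φ j k x)]
    funext k
    show ∑ j', φ j' k ((Pi.single j x : J → N) j') = φ j k x
    rw [Finset.sum_eq_single j]
    · simp
    · intro b _ hb; simp [Pi.single_eq_of_ne hb]
    · simp
  rw [← h1, ← show g' _ = g _ from hg' _, h2, map_sum]
  rfl

end Character

section Purity

variable {A : Type u} [Ring A]

lemma isPureEmbedding_of_forall {L M : Type u} [AddCommGroup L] [AddCommGroup M]
    [Module A L] [Module A M] (i : L →ₗ[A] M)
    (H : ∀ (m n : ℕ) (r : Matrix (Fin m) (Fin n) A) (l : Fin m → L),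
      (∃ x : Fin n → M, ∀ j, (∑ k, r j k • x k) = i (l j)) →
      ∃ y : Fin n → L, ∀ j, (∑ k, r j k • y k) = l j) : IsPureEmbedding A i := by
  refine ⟨(injective_iff_map_eq_zero i).2 fun x hx => ?_, H⟩
  obtain ⟨y, hy⟩ := H 1 0 0 (fun _ => x) ⟨0, fun j => by simp [hx]⟩
  simpa using (hy 0).symm

lemma IsPureEmbedding.comp {L M N : Type u} [AddCommGroup L] [AddCommGroup M] [AddCommGroup N]
    [Module A L] [Module A M] [Module A N] {i : L →ₗ[A] M} {i' : M →ₗ[A] N}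
    (hi' : IsPureEmbedding A i') (hi : IsPureEmbedding A i) :
    IsPureEmbedding A (i'.comp i) :=
  ⟨hi'.1.comp hi.1, fun m n r l h => hi.2 m n r l (hi'.2 m n r (fun j => i (l j)) h)⟩

lemma IsPureEmbedding.exists_solution {L M : Type u} [AddCommGroup L] [AddCommGroup M]
    [Module A L] [Module A M] {i : L →ₗ[A] M} (hi : IsPureEmbedding A i)
    {J K : Type*} [Fintype J] [Fintype K] (r : J → K → A) (l : J → L)
    (h : ∃ x : K → M, ∀ j, ∑ k, r j k • x k = i (l j)) :
    ∃ y : K → L, ∀ j, ∑ k, r j k • y k = l j := by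
  obtain ⟨x, hx⟩ := h
  let eJ := Fintype.equivFin J
  let eK := Fintype.equivFin K
  obtain ⟨y, hy⟩ := hi.2 _ _ (fun j k => r (eJ.symm j) (eK.symm k)) (fun j => l (eJ.symm j))
    ⟨fun k => x (eK.symm k), fun j => by
      rw [← hx, ← eK.symm.sum_comp]⟩
  refine ⟨fun k => y (eK k), fun j => ?_⟩
  have := hy (eJ j)
  rw [← eK.sum_comp] at this
  simpa using this

/-- The canonical embedding of a module in its double character module is pure. -/
lemma exists_pureEmbedding_bidual (M : Type u) [AddCommGroup M] [Module A M] :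
    ∃ i : M →ₗ[A] Character (Character M), IsPureEmbedding A i := by
  let ev : M →ₗ[A] Character (Character M) :=
    { toFun := fun m => AddMonoidHom.mk' (fun f : Character M => f m) fun _ _ => rfl
      map_add' := fun x y => Character.ext fun f => map_add f x y
      map_smul' := fun a x => rfl }
  have hev : ∀ m (f : Character M), ev m f = f m := fun _ _ => rfl
  refine ⟨ev, isPureEmbedding_of_forall ev fun m n r l => ?_⟩
  rintro ⟨x, hx⟩
  classical
  let h : (Fin n → M) →+ (Fin m → M) :=
    { toFun := fun y j => ∑ k, r j k • y k
      map_zero' := by ext; simp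
      map_add' := fun v w => by ext; simp [Finset.sum_add_distrib] }
  by_contra hl
  obtain ⟨g, hg, hgl⟩ := Character.exists_apply_ne_zero h l
    (fun ⟨y, hy⟩ => hl ⟨y, fun j => congrFun hy j⟩)
  apply hgl
  let f : Fin m → Character M := fun j =>
    AddMonoidHom.comp (g : (Fin m → M) →+ RatCircle) (AddMonoidHom.single (fun _ : Fin m => M) j)
  have hf : ∀ v : Fin m → M, g v = ∑ j, f j (v j) := fun v => by
    conv_lhs => rw [← Finset.univ_sum_single v, map_sum]
    rfl
  have hfr : ∀ k, ∑ j, op (r j k) • f j = 0 := fun k => by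
    refine Character.ext fun a => ?_
    rw [Character.sum_apply]
    refine Eq.trans ?_ (hg (Pi.single k a))
    rw [hf]
    refine Finset.sum_congr rfl fun j _ => ?_
    show f j (r j k • a) = f j (∑ k', r j k' • Pi.single (M := fun _ => M) k a k')
    rw [Finset.sum_eq_single k]
    · simp
    · intro b _ hb; simp [Pi.single_eq_of_ne hb]
    · simp
  rw [hf]
  calc ∑ j, f j (l j) = ∑ j, ∑ k, (r j k • x k) (f j) :=
        Finset.sum_congr rfl fun j _ => by rw [← hev, ← hx]; exact Character.sum_apply _ _ _
    _ = ∑ k, x k (∑ j, op (r j k) • f j) := by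
        rw [Finset.sum_comm]
        refine Finset.sum_congr rfl fun k _ => ?_
        rw [map_sum]
        rfl
    _ = 0 := by simp [hfr]

/-- A finite linear system solvable in a direct limit is solvable at some stage. -/
lemma exists_solution_at_stage {ι : Type u} [Preorder ι] [IsDirected ι (· ≤ ·)] [Nonempty ι]
    [DecidableEq ι] {G : ι → Type u} [∀ i, AddCommGroup (G i)] [∀ i, Module A (G i)]
    {f : ∀ i j, i ≤ j → G i →ₗ[A] G j} [DirectedSystem G (fun i j h => f i j h)]
    {J K : Type*} [Fintype J] [Fintype K] (r : J → K → A) (i : ι) (l : J → G i)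
    (y : K → Module.DirectLimit G f)
    (hy : ∀ j, ∑ k, r j k • y k = Module.DirectLimit.of A ι G f i (l j)) :
    ∃ (i' : ι) (h : i ≤ i') (y' : K → G i'),
      (∀ k, Module.DirectLimit.of A ι G f i' (y' k) = y k) ∧
      ∀ j, ∑ k, r j k • y' k = f i i' h (l j) := by
  classical
  choose a b hab using fun k => Module.DirectLimit.exists_of (y k)
  obtain ⟨p, hp⟩ := Finset.exists_le (insert i (Finset.univ.image a))
  have hip : i ≤ p := hp i (Finset.mem_insert_self _ _)
  have hap : ∀ k, a k ≤ p := fun k =>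
    hp _ (Finset.mem_insert_of_mem (Finset.mem_image_of_mem _ (Finset.mem_univ k)))
  let z : K → G p := fun k => f (a k) p (hap k) (b k)
  have hz : ∀ k, Module.DirectLimit.of A ι G f p (z k) = y k := fun k => by
    rw [← hab k]; exact Module.DirectLimit.of_f
  have hzero : ∀ j, Module.DirectLimit.of A ι G f p
      (∑ k, r j k • z k - f i p hip (l j)) = 0 := fun j => by
    rw [map_sub, map_sum, Module.DirectLimit.of_f, ← hy j, sub_eq_zero]
    exact Finset.sum_congr rfl fun k _ => by rw [map_smul, hz]
  choose c hpc hc using fun j => Module.DirectLimit.of.zero_exact (hzero j)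
  obtain ⟨q, hq⟩ := Finset.exists_le (insert p (Finset.univ.image c))
  have hpq : p ≤ q := hq p (Finset.mem_insert_self _ _)
  have hcq : ∀ j, c j ≤ q := fun j =>
    hq _ (Finset.mem_insert_of_mem (Finset.mem_image_of_mem _ (Finset.mem_univ j)))
  refine ⟨q, hip.trans hpq, fun k => f p q hpq (z k), fun k => ?_, fun j => ?_⟩
  · rw [Module.DirectLimit.of_f, hz]
  · have h1 : f p q hpq (∑ k, r j k • z k - f i p hip (l j)) = 0 := by
      have h2 := congrArg (f (c j) q (hcq j)) (hc j)
      rw [map_zero] at h2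
      rw [← h2]
      exact (DirectedSystem.map_map (f := fun i j h => f i j h) (hpc j) (hcq j) _).symm
    rw [map_sub, sub_eq_zero, map_sum] at h1
    rw [← DirectedSystem.map_map (f := fun i j h => f i j h) hip hpq (l j), ← h1]
    simp

end Purity

section Membership

variable {R : Type u} [Ring R]

/-- A module satisfying every implication between finite linear systems that holds throughout a
definable subcategory belongs to it. -/
lemma mem_of_forall_implication {S : ModuleCat.{u} R → Prop} (hdef : IsDefinable R S)
    (X : Type u) [AddCommGroup X] [Module R X]
    (H : ∀ K : Finset (X →₀ R), (∀ z ∈ K, Finsupp.linearCombination R (id : X → X) z = 0) →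
      ∀ (m n : ℕ) (r : Matrix (Fin m) (Fin n) R) (l : Fin m → X →₀ R),
      (∀ A : ModuleCat.{u} R, S A → ∀ u : (X →₀ R) →ₗ[R] A, (∀ z ∈ K, u z = 0) →
        ∃ y : Fin n → A, ∀ j, ∑ k, r j k • y k = u (l j)) →
      ∃ y : Fin n → X, ∀ j, ∑ k, r j k • y k =
        Finsupp.linearCombination R (id : X → X) (l j)) :
    S (ModuleCat.of R X) := by
  classical
  set π := Finsupp.linearCombination R (id : X → X)
  let I := Finset (LinearMap.ker π)
  have key : ∀ K : I, ∃ (A : ModuleCat.{u} R) (u : (X →₀ R) →ₗ[R] A), S A ∧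
      (∀ z ∈ K, u z = 0) ∧
      ∀ (m n : ℕ) (r : Matrix (Fin m) (Fin n) R) (l : Fin m → X →₀ R),
        (∃ y : Fin n → A, ∀ j, ∑ k, r j k • y k = u (l j)) →
        ∃ y : Fin n → X, ∀ j, ∑ k, r j k • y k = π (l j) := by
    intro K
    let Sys := {p : Σ (m n : ℕ), Matrix (Fin m) (Fin n) R × (Fin m → X →₀ R) //
      ¬ ∃ y : Fin p.2.1 → X, ∀ j, ∑ k, p.2.2.1 j k • y k = π (p.2.2.2 j)}
    have step : ∀ p : Sys, ∃ (A : ModuleCat.{u} R) (u : (X →₀ R) →ₗ[R] A), S A ∧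
        (∀ z ∈ K, u z = 0) ∧
        ¬ ∃ y : Fin p.1.2.1 → A, ∀ j, ∑ k, p.1.2.2.1 j k • y k = u (p.1.2.2.2 j) := by
      rintro ⟨⟨m, n, r, l⟩, hp⟩
      by_contra hcon
      refine hp (H (K.image Subtype.val) ?_ m n r l fun A hA u hu => ?_)
      · intro z hz
        obtain ⟨w, -, rfl⟩ := Finset.mem_image.1 hz
        exact w.2
      · by_contra hy
        exact hcon ⟨A, u, hA, fun z hz => hu _ (Finset.mem_image_of_mem _ hz), hy⟩
    choose A u hA hu hfail using step
    refine ⟨ModuleCat.of R (∀ p, A p), LinearMap.pi u, hdef.1 Sys A hA,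
      fun z hz => funext fun p => hu p z hz, fun m n r l => ?_⟩
    rintro ⟨y, hy⟩
    by_contra hcon
    refine hfail ⟨⟨m, n, r, l⟩, hcon⟩ ⟨fun k => y k ⟨⟨m, n, r, l⟩, hcon⟩, fun j => ?_⟩
    have := congrFun (hy j) ⟨⟨m, n, r, l⟩, hcon⟩
    rw [Finset.sum_apply] at this
    exact this
  choose A u hA hu hsol using key
  let G : I → Type u := fun K => ∀ K' : {K' : I // K ≤ K'}, A K'.1
  let f : ∀ K L : I, K ≤ L → G K →ₗ[R] G L := fun K L h =>
    LinearMap.pi fun K' => LinearMap.proj (R := R)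
      (φ := fun K'' : {K'' : I // K ≤ K''} => (A K''.1 : Type u)) ⟨K'.1, h.trans K'.2⟩
  have : DirectedSystem G (fun i j h => f i j h) :=
    { map_self := fun _ _ => rfl
      map_map := fun _ _ _ _ _ _ => rfl }
  let U : ∀ K : I, (X →₀ R) →ₗ[R] G K := fun K => LinearMap.pi fun K' => u K'.1
  have hUf : ∀ K L (h : K ≤ L) x, f K L h (U K x) = U L x := fun _ _ _ _ => rfl
  have hDL : S (ModuleCat.of R (Module.DirectLimit G f)) :=
    hdef.2.1 I G f fun K => hdef.1 _ (fun K' : {K' : I // K ≤ K'} => A K'.1) fun K' => hA _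
  let Ψ : (X →₀ R) →ₗ[R] Module.DirectLimit G f :=
    (Module.DirectLimit.of R I G f ∅).comp (U ∅)
  have hΨ : ∀ K x, Ψ x = Module.DirectLimit.of R I G f K (U K x) := fun K x => by
    have hle : (∅ : I) ≤ K := Finset.empty_subset K
    rw [← hUf ∅ K hle x, Module.DirectLimit.of_f (hij := hle)]; rfl
  have hker : LinearMap.ker π ≤ LinearMap.ker Ψ := fun z hz => by
    rw [LinearMap.mem_ker, hΨ {⟨z, hz⟩}]
    have : U {⟨z, hz⟩} z = 0 := funext fun K' =>
      hu K'.1 ⟨z, hz⟩ (K'.2 (Finset.mem_singleton_self _))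
    rw [this, map_zero]
  have hsurj : Function.Surjective π := Finsupp.linearCombination_id_surjective R X
  let e : X →ₗ[R] Module.DirectLimit G f :=
    ((LinearMap.ker π).liftQ Ψ hker).comp (π.quotKerEquivOfSurjective hsurj).symm.toLinearMap
  have he : ∀ z, e (π z) = Ψ z := fun z => by
    have : (π.quotKerEquivOfSurjective hsurj).symm (π z) = Submodule.Quotient.mk z := by
      rw [LinearEquiv.symm_apply_eq]; rfl
    show (LinearMap.ker π).liftQ Ψ hker ((π.quotKerEquivOfSurjective hsurj).symm (π z)) = Ψ z
    rw [this]; rfl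
  refine hdef.2.2 (ModuleCat.of R X) _ e (isPureEmbedding_of_forall e fun m n r l => ?_) hDL
  rintro ⟨y, hy⟩
  choose z hz using fun j => hsurj (l j)
  obtain ⟨K, _, y', -, hy'⟩ := exists_solution_at_stage (f := f) r ∅ (fun j => U ∅ (z j)) y
    (fun j => by rw [hy, ← hz, he]; rfl)
  obtain ⟨w, hw⟩ := hsol K m n r z ⟨fun k => y' k ⟨K, le_rfl⟩, fun j => by
    have := congrFun (hy' j) ⟨K, le_rfl⟩
    rw [Finset.sum_apply] at this
    exact this⟩
  exact ⟨w, fun j => by rw [hw, hz]⟩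

lemma linearCombination_eq_sum_of_support_subset {X M : Type*} [AddCommGroup M] [Module R M]
    (v : X → M) (T : Finset X) (z : X →₀ R) (hz : z.support ⊆ T) :
    Finsupp.linearCombination R v z = ∑ t : T, z t • v t := by
  rw [Finsupp.linearCombination_apply, Finsupp.sum_of_support_subset z hz _ (by simp),
    ← Finset.sum_coe_sort]

lemma character_mem_of_Qclass {S : ModuleCat.{u} R → Prop} (hdef : IsDefinable R S)
    (N : ModuleCat.{u} Rᵐᵒᵖ) (hN : Qclass S N) :
    S (ModuleCat.of R (Character (N : Type u))) := by
  classical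
  obtain ⟨ι, A, hA, emb, hemb⟩ := hN
  refine mem_of_forall_implication hdef _ fun K hK m n r l H => ?_
  let T : Finset (Character (N : Type u)) :=
    K.biUnion Finsupp.support ∪ Finset.univ.biUnion fun j => (l j).support
  have hKT : ∀ z ∈ K, z.support ⊆ T := fun z hz =>
    (Finset.subset_biUnion_of_mem Finsupp.support hz).trans Finset.subset_union_left
  have hlT : ∀ j, (l j).support ⊆ T := fun j =>
    (Finset.subset_biUnion_of_mem (fun j => (l j).support) (Finset.mem_univ j)).trans
      Finset.subset_union_right
  have hann : ∀ v : ULift.{u} (Fin m) → (N : Type u),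
      (∀ k : ULift.{u} (Fin n), ∑ j, op (r j.down k.down) • v j = 0) →
      ∑ j, (Finsupp.linearCombination R (id : Character (N : Type u) → _) (l j.down)) (v j) = 0 := by
    intro v hv
    rw [← Equiv.ulift.symm.sum_comp]
    replace hv : ∀ k, ∑ j, op (r j k) • v ⟨j⟩ = 0 := fun k => by
      rw [← hv ⟨k⟩, ← Equiv.ulift.symm.sum_comp]; rfl
    obtain ⟨η, hη⟩ := hemb.exists_solution (fun (t : T) (z : K) => op (z.1 t.1))
      (fun t => ∑ j, op (l j t.1) • v ⟨j⟩) (by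
        suffices hcomp : ∀ i, ∃ h : K → Character (A i : Type u), ∀ t : T,
            ∑ z : K, op (z.1 t.1) • h z = emb (∑ j, op (l j t.1) • v ⟨j⟩) i by
          choose h hh using hcomp
          refine ⟨fun z i => h i z, fun t => funext fun i => ?_⟩
          rw [← hh i t, Finset.sum_apply]
          rfl
        intro i
        obtain ⟨h, hh⟩ := Character.exists_solution (J := T) (K := K)
          (fun t z => DistribSMul.toAddMonoidHom (A i : Type u) (z.1 t.1))
          (fun t => emb (∑ j, op (l j t.1) • v ⟨j⟩) i) (by
            intro a ha
            let b : Character (N : Type u) → A i := fun x => if hx : x ∈ T then a ⟨x, hx⟩ else 0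
            have hb : ∀ z : Character (N : Type u) →₀ R, z.support ⊆ T →
                Finsupp.linearCombination R b z = ∑ t : T, z t • a t := fun z hz => by
              rw [linearCombination_eq_sum_of_support_subset b T z hz]
              exact Finset.sum_congr rfl fun t _ => by simp [b]
            obtain ⟨w, hw⟩ := H (A i) (hA i) (Finsupp.linearCombination R b)
              (fun z hz => by rw [hb z (hKT z hz)]; exact ha ⟨z, hz⟩)
            have hE : ∀ k, ∑ j, op (r j k) • emb (v ⟨j⟩) i = 0 := fun k => by
              have := congrFun (congrArg emb (hv k)) i
              rw [map_sum, map_zero, Finset.sum_apply] at this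
              simp only [map_smul] at this
              exact this
            calc ∑ t : T, (emb (∑ j, op (l j t.1) • v ⟨j⟩) i) (a t)
                = ∑ t : T, ∑ j, emb (v ⟨j⟩) i (l j t.1 • a t) := by
                  refine Finset.sum_congr rfl fun t _ => ?_
                  rw [map_sum, Finset.sum_apply, Character.sum_apply]
                  refine Finset.sum_congr rfl fun j _ => ?_
                  rw [map_smul]
                  rfl
              _ = ∑ j, emb (v ⟨j⟩) i (∑ k, r j k • w k) := by
                  rw [Finset.sum_comm]
                  refine Finset.sum_congr rfl fun j _ => ?_
                  rw [hw, hb _ (hlT j), map_sum]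
              _ = ∑ k, (∑ j, op (r j k) • emb (v ⟨j⟩) i) (w k) := by
                  simp only [map_sum, Character.sum_apply]
                  rw [Finset.sum_comm]
                  rfl
              _ = 0 := Finset.sum_eq_zero fun k _ => by rw [hE]; rfl)
        refine ⟨h, fun t => Character.ext fun x => ?_⟩
        rw [Character.sum_apply]
        exact hh t x)
    calc ∑ j, (Finsupp.linearCombination R (id : Character (N : Type u) → _) (l j)) (v ⟨j⟩)
        = ∑ t : T, t.1 (∑ j, op (l j t.1) • v ⟨j⟩) := by
          simp only [map_sum]
          rw [Finset.sum_comm]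
          refine Finset.sum_congr rfl fun j _ => ?_
          rw [linearCombination_eq_sum_of_support_subset id T _ (hlT j), Character.sum_apply]
          rfl
      _ = ∑ z : K, (Finsupp.linearCombination R (id : Character (N : Type u) → _) z.1) (η z) := by
          simp only [← hη, map_sum]
          rw [Finset.sum_comm]
          refine Finset.sum_congr rfl fun z _ => ?_
          rw [linearCombination_eq_sum_of_support_subset id T _ (hKT z.1 z.2), Character.sum_apply]
          rfl
      _ = 0 := Finset.sum_eq_zero fun z _ => by rw [hK z.1 z.2]; rfl
  obtain ⟨y, hy⟩ := Character.exists_solution (J := ULift.{u} (Fin m)) (K := ULift.{u} (Fin n))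
    (fun j k => DistribSMul.toAddMonoidHom (N : Type u) (op (r j.down k.down)))
    (fun j => Finsupp.linearCombination R (id : Character (N : Type u) → _) (l j.down)) hann
  refine ⟨fun k => y ⟨k⟩, fun j => Character.ext fun x => ?_⟩
  rw [Character.sum_apply, ← hy ⟨j⟩ x, ← Equiv.ulift.symm.sum_comp]
  rfl

lemma Qclass_character {S : ModuleCat.{u} R → Prop} (M : ModuleCat.{u} R) (hM : S M) :
    Qclass S (ModuleCat.of Rᵐᵒᵖ (Character (M : Type u))) := by
  refine ⟨PUnit, fun _ => M, fun _ => hM, LinearMap.pi fun _ => LinearMap.id,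
    isPureEmbedding_of_forall _ fun m n r l => ?_⟩
  rintro ⟨x, hx⟩
  refine ⟨fun k => x k ⟨⟩, fun j => ?_⟩
  have := congrFun (hx j) ⟨⟩
  rw [Finset.sum_apply] at this
  exact this

lemma pureSubClosed_Qclass (S : ModuleCat.{u} R → Prop) : PureSubClosed Rᵐᵒᵖ (Qclass S) := by
  rintro N M i hi ⟨ι, A, hA, emb, hemb⟩
  exact ⟨ι, A, hA, emb.comp i, hemb.comp hi⟩

lemma prodClosed_Qclass (S : ModuleCat.{u} R → Prop) : ProdClosed Rᵐᵒᵖ (Qclass S) := by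
  intro κ N hN
  choose ι A hA emb hemb using hN
  let e : (∀ i, (N i : Type u)) →ₗ[Rᵐᵒᵖ] ∀ p : Σ i, ι i, Character (A p.1 p.2 : Type u) :=
    LinearMap.pi fun p => (LinearMap.proj p.2).comp ((emb p.1).comp (LinearMap.proj p.1))
  refine ⟨Σ i, ι i, fun p => A p.1 p.2, fun p => hA p.1 p.2, e,
    isPureEmbedding_of_forall e fun m n r l => ?_⟩
  rintro ⟨x, hx⟩
  have hcomp : ∀ i, ∃ y : Fin n → N i, ∀ j, ∑ k, r j k • y k = l j i := fun i =>
    (hemb i).2 m n r (fun j => l j i) ⟨fun k s => x k ⟨i, s⟩, fun j => funext fun s => by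
      have := congrFun (hx j) ⟨i, s⟩
      rw [Finset.sum_apply] at this
      rw [Finset.sum_apply]
      exact this⟩
  choose y hy using hcomp
  refine ⟨fun k i => y i k, fun j => funext fun i => ?_⟩
  rw [← hy i j]
  exact Finset.sum_apply i Finset.univ (fun k => r j k • fun i => y i k)

lemma Qclass_of_character_mem {S : ModuleCat.{u} R → Prop} (N : ModuleCat.{u} Rᵐᵒᵖ)
    (hN : S (ModuleCat.of R (Character (N : Type u)))) : Qclass S N := by
  obtain ⟨i, hi⟩ := exists_pureEmbedding_bidual (A := Rᵐᵒᵖ) (N : Type u)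
  exact pureSubClosed_Qclass S N (ModuleCat.of Rᵐᵒᵖ (Character (Character (N : Type u)))) i hi
    (Qclass_character (ModuleCat.of R (Character (N : Type u))) hN)

lemma dirLimClosed_Qclass {S : ModuleCat.{u} R → Prop} (hdef : IsDefinable R S) :
    DirLimClosed Rᵐᵒᵖ (Qclass S) := by
  intro ι _ _ _ _ G _ _ f _ hG
  let D := Module.DirectLimit G f
  let o := Module.DirectLimit.of Rᵐᵒᵖ ι G f
  refine Qclass_of_character_mem (ModuleCat.of Rᵐᵒᵖ D) ?_
  have hprod := hdef.1 ι (fun i => ModuleCat.of R (Character (G i)))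
    fun i => character_mem_of_Qclass hdef _ (hG i)
  let e : Character D →ₗ[R] ∀ i, Character (G i) :=
    LinearMap.pi fun i =>
      { toFun := fun g => AddMonoidHom.comp (g : D →+ RatCircle) (o i).toAddMonoidHom
        map_add' := fun _ _ => rfl
        map_smul' := fun a g => Character.ext fun x =>
          congrArg g ((o i).map_smul (op a) x).symm }
  refine hdef.2.2 (ModuleCat.of R (Character D)) _ e
    (isPureEmbedding_of_forall e fun m n r g => ?_) hprod
  rintro ⟨y, hy⟩
  have hann : ∀ v : ULift.{u} (Fin m) → D,
      (∀ k : ULift.{u} (Fin n), ∑ j, op (r j.down k.down) • v j = 0) →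
      ∑ j, (g j.down) (v j) = 0 := by
    intro v hv
    rw [← Equiv.ulift.symm.sum_comp]
    replace hv : ∀ k, ∑ j, op (r j k) • v ⟨j⟩ = 0 := fun k => by
      rw [← hv ⟨k⟩, ← Equiv.ulift.symm.sum_comp]; rfl
    obtain ⟨i, _, v', hv', hv0⟩ := exists_solution_at_stage (f := f)
      (fun (k : Fin n) (j : Fin m) => op (r j k)) (Classical.arbitrary ι) (fun _ => 0)
      (fun j => v ⟨j⟩) (fun k => by rw [hv, map_zero])
    calc ∑ j, g j (v ⟨j⟩) = ∑ j, ∑ k, (r j k • y k i) (v' j) := by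
          refine Finset.sum_congr rfl fun j _ => ?_
          rw [← hv' j, ← Character.sum_apply]
          have := congrFun (hy j) i
          rw [Finset.sum_apply] at this
          exact (DFunLike.congr_fun this (v' j)).symm
      _ = ∑ k, y k i (∑ j, op (r j k) • v' j) := by
          rw [Finset.sum_comm]
          simp only [map_sum]
          rfl
      _ = 0 := Finset.sum_eq_zero fun k _ => by rw [hv0]; simp
  obtain ⟨w, hw⟩ := Character.exists_solution (J := ULift.{u} (Fin m)) (K := ULift.{u} (Fin n))
    (fun j k => DistribSMul.toAddMonoidHom D (op (r j.down k.down)))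
    (fun j => g j.down) hann
  refine ⟨fun k => w ⟨k⟩, fun j => Character.ext fun x => ?_⟩
  rw [Character.sum_apply, ← hw ⟨j⟩ x, ← Equiv.ulift.symm.sum_comp]
  rfl

end Membership

theorem elementary_dual_of_definable_subcategory
    {R : Type u} [Ring R] (S : ModuleCat.{u} R → Prop)
    (hiso : ∀ (M M' : ModuleCat.{u} R), S M → ((M : Type u) ≃ₗ[R] (M' : Type u)) → S M')
    (hdef : IsDefinable R S) :
    IsDefinable Rᵐᵒᵖ (Qclass S) ∧
    ∀ M : ModuleCat.{u} R,
      S M ↔ Qclass S (ModuleCat.of Rᵐᵒᵖ (Character (M : Type u))) := by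
  refine ⟨⟨prodClosed_Qclass S, dirLimClosed_Qclass hdef, pureSubClosed_Qclass S⟩,
    fun M => ⟨Qclass_character M, fun hM => ?_⟩⟩
  obtain ⟨i, hi⟩ := exists_pureEmbedding_bidual (A := R) (M : Type u)
  exact hdef.2.2 M (ModuleCat.of R (Character (Character (M : Type u)))) i hi
    (character_mem_of_Qclass hdef _ hM)

end
end

section
/- Let R be a ring and let B be a class of finitely presented left R-modules closed under isomorphism, finite direct sums and direct summands. For a left R-module M the following are equivalent: (i) M is isomorphic to the colimit of a directed system of modules belonging to B; (ii) the character module M* is isomorphic to a direct summand of a direct product ∏_{i∈I} B_i* where each B_i ∈ B. -/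
universe u

open MulOpposite DirectSum

noncomputable section

/-- A presentation of `M` as the colimit of a directed system of modules in the class `B`. -/
structure DirectedColimitPresentation (R : Type u) [Ring R] (B : ModuleCat.{u} R → Prop)
    (M : Type u) [AddCommGroup M] [Module R M] : Type (u + 1) where
  ι : Type u
  [pre : Preorder ι]
  [dec : DecidableEq ι]
  directed : IsDirected ι (· ≤ ·)
  nonempty : Nonempty ι
  G : ι → Type u
  [acg : ∀ i, AddCommGroup (G i)]
  [mod : ∀ i, Module R (G i)]
  mem : ∀ i, B (ModuleCat.of R (G i))
  f : ∀ i j, i ≤ j → G i →ₗ[R] G j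
  dirsys : DirectedSystem G (fun i j h => f i j h)
  equiv : M ≃ₗ[R] Module.DirectLimit G f

/-- By injectivity of `ℚ/ℤ`, a homomorphism `n : A → ℚ/ℤ` vanishing on the kernel of `f : A → B`
factors through `f`. -/
lemma exists_addMonoidHom_comp_eq {A B : Type*} [AddCommGroup A] [AddCommGroup B]
    (f : A →+ B) (n : A →+ RatCircle) (h : ∀ a, f a = 0 → n a = 0) :
    ∃ y : B →+ RatCircle, ∀ a, y (f a) = n a := by
  obtain ⟨y, hy⟩ := (Module.Baer.of_divisible RatCircle).extension_property_addMonoidHom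
    (QuotientAddGroup.kerLift f) (QuotientAddGroup.kerLift_injective f)
    (QuotientAddGroup.lift f.ker n fun a ha => h a ha)
  refine ⟨y, fun a => ?_⟩
  exact DFunLike.congr_fun hy (QuotientAddGroup.mk a)

section GermSplitting

/-- A retraction of the embedding of `ℚ/ℤ` into its group of germs at infinity along `ι`. -/
lemma exists_germ_retraction (ι : Type u) [Preorder ι] [IsDirected ι (· ≤ ·)] [Nonempty ι] :
    ∃ L : Filter.Germ (Filter.atTop : Filter ι) RatCircle →+ RatCircle,
      ∀ c : RatCircle, L (c : Filter.Germ (Filter.atTop : Filter ι) RatCircle) = c :=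
  exists_addMonoidHom_comp_eq
    (f := ({ toFun := fun c => (c : Filter.Germ (Filter.atTop : Filter ι) RatCircle)
             map_zero' := rfl
             map_add' := fun _ _ => rfl } :
      RatCircle →+ Filter.Germ (Filter.atTop : Filter ι) RatCircle))
    (AddMonoidHom.id RatCircle) fun _ ha => Filter.Germ.const_inj.1 ha

variable {R : Type u} [Ring R] {ι : Type u} [Preorder ι] [DecidableEq ι]
  {G : ι → Type u} [∀ i, AddCommGroup (G i)] [∀ i, Module R (G i)]
  (f : ∀ i j, i ≤ j → G i →ₗ[R] G j) [DirectedSystem G (fun i j h => f i j h)]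

open Classical in
/-- The map sending `x : G j` to the germ at infinity of `k ↦ f j k x`, in the direct sum of
the `G k`. -/
def toGerm (j : ι) : G j →ₗ[R] Filter.Germ (Filter.atTop : Filter ι) (⨁ k, G k) where
  toFun x := ((fun k => if h : j ≤ k then DirectSum.lof R ι G k (f j k h x) else 0 :
    ι → ⨁ k, G k) : Filter.Germ (Filter.atTop : Filter ι) (⨁ k, G k))
  map_add' x y := by
    rw [← Filter.Germ.coe_add]
    congr 1
    funext k
    by_cases h : j ≤ k <;> simp [h]
  map_smul' r x := by
    rw [RingHom.id_apply, ← Filter.Germ.coe_smul]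
    congr 1
    funext k
    by_cases h : j ≤ k <;> simp [h]

lemma toGerm_f (i j : ι) (h : i ≤ j) (x : G i) : toGerm f j (f i j h x) = toGerm f i x := by
  refine Filter.Germ.coe_eq.2 ?_
  filter_upwards [Filter.eventually_ge_atTop j] with k hk
  have hik : i ≤ k := h.trans hk
  rw [dif_pos hk, dif_pos hik]
  congr 1
  exact DirectedSystem.map_map' f h hk x

end GermSplitting

/-- Characters of a direct sum are families of characters. -/
def characterDirectSumEquiv {R : Type u} [Ring R] {ι : Type u} [DecidableEq ι] (G : ι → Type u)
    [∀ i, AddCommGroup (G i)] [∀ i, Module R (G i)] :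
    (∀ i, Character (G i)) ≃ₗ[Rᵐᵒᵖ] Character (⨁ i, G i) where
  toFun ψ := (DirectSum.toAddMonoid ψ : (⨁ i, G i) →+ RatCircle)
  invFun φ i := (φ : (⨁ i, G i) →+ RatCircle).comp (DirectSum.of G i)
  map_add' φ ψ := by
    refine DirectSum.addHom_ext (fun i x => ?_)
    exact (DirectSum.toAddMonoid_of (fun i => (φ i + ψ i : G i →+ RatCircle)) i x).trans
      (congrArg₂ (· + ·) (DirectSum.toAddMonoid_of (fun i => (φ i : G i →+ RatCircle)) i x)
        (DirectSum.toAddMonoid_of (fun i => (ψ i : G i →+ RatCircle)) i x)).symm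
  map_smul' r ψ := by
    refine DirectSum.addHom_ext (fun i x => ?_)
    refine (DirectSum.toAddMonoid_of (fun i => ((r • ψ i : Character (G i)) : G i →+ RatCircle))
      i x).trans ?_
    change ψ i (r.unop • x) = DirectSum.toAddMonoid (fun i => (ψ i : G i →+ RatCircle))
      (r.unop • DirectSum.lof R ι G i x)
    rw [← map_smul]
    exact (DirectSum.toAddMonoid_of (fun i => (ψ i : G i →+ RatCircle)) i (r.unop • x)).symm
  left_inv ψ := by
    funext i
    refine Character.ext fun x => ?_
    exact DirectSum.toAddMonoid_of (fun i => (ψ i : G i →+ RatCircle)) i x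
  right_inv φ := by
    refine DirectSum.addHom_ext (fun i x => ?_)
    exact DirectSum.toAddMonoid_of _ i x

/-- The map on character modules induced by a linear map. -/
def Character.dual {R : Type u} [Ring R] {M N : Type u} [AddCommGroup M] [AddCommGroup N]
    [Module R M] [Module R N] (f : M →ₗ[R] N) : Character N →ₗ[Rᵐᵒᵖ] Character M where
  toFun φ := (φ : N →+ RatCircle).comp f.toAddMonoidHom
  map_add' _ _ := rfl
  map_smul' r φ := Character.ext fun m => congrArg φ (f.map_smul r.unop m).symm

lemma Character.dual_apply {R : Type u} [Ring R] {M N : Type u} [AddCommGroup M] [AddCommGroup N]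
    [Module R M] [Module R N] (f : M →ₗ[R] N) (φ : Character N) (m : M) :
    Character.dual f φ m = φ (f m) := rfl

/-- The character module of a directed colimit is a direct summand of the product of the
character modules of the terms. -/
lemma isDirectSummand_character_directLimit {R : Type u} [Ring R]
    {ι : Type u} [Preorder ι] [IsDirected ι (· ≤ ·)] [Nonempty ι] [DecidableEq ι]
    (G : ι → Type u) [∀ i, AddCommGroup (G i)] [∀ i, Module R (G i)]
    (f : ∀ i j, i ≤ j → G i →ₗ[R] G j) [DirectedSystem G (fun i j h => f i j h)]
    (M : Type u) [AddCommGroup M] [Module R M] (e : M ≃ₗ[R] Module.DirectLimit G f) :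
    IsDirectSummand Rᵐᵒᵖ (Character M) (∀ i, Character (G i)) := by
  obtain ⟨L, hL⟩ := exists_germ_retraction ι
  let σ : M →ₗ[R] Filter.Germ (Filter.atTop : Filter ι) (⨁ k, G k) :=
    Module.DirectLimit.lift R ι G f (toGerm f) (toGerm_f f) ∘ₗ e.toLinearMap
  let mapGerm (φ : Character (⨁ k, G k)) :
      Filter.Germ (Filter.atTop : Filter ι) (⨁ k, G k) →+
        Filter.Germ (Filter.atTop : Filter ι) RatCircle :=
    { toFun := Filter.Germ.map φ
      map_zero' := congrArg _ (funext fun _ => map_zero φ)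
      map_add' := fun a b => Filter.Germ.inductionOn₂ a b fun _ _ =>
        congrArg _ (funext fun _ => map_add φ _ _) }
  let ρ : Character (⨁ k, G k) →ₗ[Rᵐᵒᵖ] Character M :=
    { toFun := fun φ => (L.comp (mapGerm φ)).comp σ.toAddMonoidHom
      map_add' := fun φ ψ => Character.ext fun m => by
        change L (Filter.Germ.map (φ + ψ) (σ m)) =
          L (Filter.Germ.map φ (σ m)) + L (Filter.Germ.map ψ (σ m))
        rw [← map_add]
        congr 1
        induction σ m using Filter.Germ.inductionOn with | _ s => rfl
      map_smul' := fun r φ => Character.ext fun m => by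
        change L (Filter.Germ.map (r • φ) (σ m)) = L (Filter.Germ.map φ (σ (r.unop • m)))
        rw [map_smul]
        congr 1
        induction σ m using Filter.Germ.inductionOn with | _ s => rfl }
  let p : (⨁ k, G k) →ₗ[R] M :=
    e.symm.toLinearMap ∘ₗ DirectSum.toModule R ι _ (Module.DirectLimit.of R ι G f)
  have hp : ∀ i x, p (DirectSum.lof R ι G i x) = e.symm (Module.DirectLimit.of R ι G f i x) :=
    fun i x => by simp [p]
  refine ⟨(characterDirectSumEquiv G).symm.toLinearMap ∘ₗ Character.dual p,
    ρ ∘ₗ (characterDirectSumEquiv G).toLinearMap, ?_⟩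
  refine LinearMap.ext fun φ => Character.ext fun m => ?_
  simp only [LinearMap.comp_apply, LinearEquiv.coe_coe, LinearEquiv.apply_symm_apply,
    LinearMap.id_apply]
  change L (Filter.Germ.map (Character.dual p φ) (σ m)) = φ m
  refine Eq.trans (congrArg L ?_) (hL (φ m))
  obtain ⟨j, x, hx⟩ := Module.DirectLimit.exists_of (e m)
  have hσ : σ m = toGerm f j x := by simp [σ, ← hx]
  rw [hσ]
  refine Filter.Germ.coe_eq.2 ?_
  filter_upwards [Filter.eventually_ge_atTop j] with k hk
  simp only [Function.comp_apply, dif_pos hk, Character.dual_apply, hp, Module.DirectLimit.of_f,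
    hx, LinearEquiv.symm_apply_apply]

lemma Character.sum_apply_s12 {M : Type u} [AddCommGroup M] {ι : Type*} (s : Finset ι)
    (φ : ι → Character M) (m : M) : (∑ k ∈ s, φ k) m = ∑ k ∈ s, φ k m :=
  map_sum ({ toFun := fun ψ => ψ m, map_zero' := rfl, map_add' := fun _ _ => rfl } :
    Character M →+ RatCircle) φ s

/-- If `Q` is finitely presented and `∑ φ k ⊗ b k` in `M* ⊗ Q` is annihilated by all linear maps
`Q → M`, then it is zero, hence is annihilated by all linear maps `M* → Q*`. -/
lemma sum_apply_eq_zero_of_forall_linearMap {R : Type u} [Ring R] {M Q : Type u} [AddCommGroup M]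
    [AddCommGroup Q] [Module R M] [Module R Q] [Module.FinitePresentation R Q] {n : ℕ}
    (φ : Fin n → Character M) (b : Fin n → Q)
    (h : ∀ g : Q →ₗ[R] M, ∑ k, φ k (g (b k)) = 0)
    (α : Character M →ₗ[Rᵐᵒᵖ] Character Q) :
    ∑ k, α (φ k) (b k) = 0 := by
  obtain ⟨t, s, p, r, hp, hex⟩ := Module.FinitePresentation.exists_fin' R Q
  choose c hc using fun k => hp (b k)
  let q : Fin t → Q := fun l => p (Pi.single l 1)
  have hpq : ∀ v, p v = ∑ l, v l • q l := fun v => by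
    conv_lhs => rw [pi_eq_sum_univ' v]
    simp [q, map_sum]
  let ρ : Fin s → Fin t → R := fun j => r (Pi.single j 1)
  have hρ : ∀ j, ∑ l, ρ j l • q l = 0 := fun j => by
    rw [← hpq]
    exact hex.apply_apply_eq_zero _
  let A : (Fin t → M) →+ (Fin s → M) :=
    { toFun := fun x j => ∑ l, ρ j l • x l
      map_zero' := by funext; simp
      map_add' := fun x y => by funext j; simp [Finset.sum_add_distrib] }
  let N : (Fin t → M) →+ RatCircle :=
    { toFun := fun x => ∑ k, φ k (∑ l, c k l • x l)
      map_zero' := by simp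
      map_add' := fun x y => by simp [Finset.sum_add_distrib] }
  obtain ⟨y, hy⟩ := exists_addMonoidHom_comp_eq A N fun x hx => by
    let g₀ : (Fin t → R) →ₗ[R] M := Fintype.linearCombination R x
    have hg₀ : LinearMap.ker p ≤ LinearMap.ker g₀ := by
      rw [hex.linearMap_ker_eq, LinearMap.range_eq_map, ← (Pi.basisFun R (Fin s)).span_eq,
        Submodule.map_span_le]
      rintro _ ⟨j, rfl⟩
      have := congrFun hx j
      simpa [g₀, Fintype.linearCombination_apply, A, ρ] using this
    let g : Q →ₗ[R] M := (LinearMap.ker p).liftQ g₀ hg₀ ∘ₗ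
      (p.quotKerEquivOfSurjective hp).symm.toLinearMap
    have hg : ∀ v, g (p v) = g₀ v := fun v => by
      have : (p.quotKerEquivOfSurjective hp).symm (p v) = Submodule.Quotient.mk v := by
        rw [LinearEquiv.symm_apply_eq]; rfl
      simp [g, this]
    have := h g
    simp only [← hc, hg] at this
    exact this
  let Y : Fin s → Character M := fun j => y.comp (AddMonoidHom.single (fun _ => M) j)
  have key : ∀ l, ∑ k, op (c k l) • φ k = ∑ j, op (ρ j l) • Y j := fun l => by
    refine Character.ext fun m => ?_
    have hN : N (Pi.single l m) = ∑ k, φ k (c k l • m) := by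
      change ∑ k, φ k (∑ l', c k l' • (Pi.single l m : Fin t → M) l') = _
      refine Finset.sum_congr rfl fun k _ => ?_
      rw [Finset.sum_eq_single l (by intro l' _ hl; simp [hl]) (by simp), Pi.single_eq_same]
    have hA : A (Pi.single l m) = ∑ j, Pi.single j (ρ j l • m) := by
      rw [Finset.univ_sum_single]
      funext j
      change ∑ l', ρ j l' • (Pi.single l m : Fin t → M) l' = _
      rw [Finset.sum_eq_single l (by intro l' _ hl; simp [hl]) (by simp), Pi.single_eq_same]
    rw [Character.sum_apply_s12, Character.sum_apply_s12]
    refine hN.symm.trans ((hy _).symm.trans ?_)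
    rw [hA, map_sum]
    rfl
  have swap : ∀ (a : ℕ) (ψ : Fin a → Character M) (d : Fin a → Fin t → R),
      ∑ k, α (ψ k) (∑ l, d k l • q l) = ∑ l, α (∑ k, op (d k l) • ψ k) (q l) := fun a ψ d => by
    simp only [map_sum, Character.sum_apply_s12, map_smul]
    exact Finset.sum_comm
  calc ∑ k, α (φ k) (b k) = ∑ k, α (φ k) (∑ l, c k l • q l) := by simp only [← hpq, hc]
    _ = ∑ j, α (Y j) (∑ l, ρ j l • q l) := by simp only [swap, key]
    _ = 0 := by simp [hρ]

/-- A linear map out of a finitely presented module factors through a member of `B`. -/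
def FactorsThroughClass {R : Type u} [Ring R] (B : ModuleCat.{u} R → Prop) {P M : Type u}
    [AddCommGroup P] [AddCommGroup M] [Module R P] [Module R M] (h : P →ₗ[R] M) : Prop :=
  ∃ (Q : ModuleCat.{u} R) (u : P →ₗ[R] Q) (v : Q →ₗ[R] M), B Q ∧ v ∘ₗ u = h

lemma prod_mem_class {R : Type u} [Ring R] {B : ModuleCat.{u} R → Prop}
    (hiso : ∀ (N N' : ModuleCat.{u} R), B N → ((N : Type u) ≃ₗ[R] (N' : Type u)) → B N')
    (hsum : ∀ (ι : Type u) [Fintype ι] (g : ι → ModuleCat.{u} R),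
      (∀ i, B (g i)) → B (ModuleCat.of R (∀ i, (g i : Type u))))
    {N N' : ModuleCat.{u} R} (hN : B N) (hN' : B N') : B (ModuleCat.of R (N × N')) := by
  let g : ULift.{u} Bool → ModuleCat.{u} R := fun b => bif b.down then N else N'
  refine hiso _ _ (hsum (ULift.{u} Bool) g ?_) ?_
  · rintro ⟨_ | _⟩
    exacts [hN', hN]
  · exact
      { toFun := fun x => (x ⟨true⟩, x ⟨false⟩)
        map_add' := fun _ _ => rfl
        map_smul' := fun _ _ => rfl
        invFun := fun x b => match b with
          | ⟨true⟩ => x.1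
          | ⟨false⟩ => x.2
        left_inv := fun x => by
          funext b
          rcases b with ⟨_ | _⟩ <;> rfl
        right_inv := fun _ => rfl }

/-- The linear maps factoring through a member of a class closed under finite direct sums form
a subgroup. -/
def factorsThroughClassAddSubgroup {R : Type u} [Ring R] (B : ModuleCat.{u} R → Prop)
    (hiso : ∀ (N N' : ModuleCat.{u} R), B N → ((N : Type u) ≃ₗ[R] (N' : Type u)) → B N')
    (hsum : ∀ (ι : Type u) [Fintype ι] (g : ι → ModuleCat.{u} R),
      (∀ i, B (g i)) → B (ModuleCat.of R (∀ i, (g i : Type u))))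
    (P M : Type u) [AddCommGroup P] [AddCommGroup M] [Module R P] [Module R M] :
    AddSubgroup (P →ₗ[R] M) where
  carrier := {h | FactorsThroughClass B h}
  zero_mem' := ⟨_, 0, 0, hsum PEmpty PEmpty.elim (fun i => i.elim), by simp⟩
  neg_mem' := by
    rintro _ ⟨Q, u, v, hQ, rfl⟩
    exact ⟨Q, u, -v, hQ, LinearMap.neg_comp _ _⟩
  add_mem' := by
    rintro _ _ ⟨Q, u, v, hQ, rfl⟩ ⟨Q', u', v', hQ', rfl⟩
    exact ⟨ModuleCat.of R (Q × Q'), u.prod u', v.coprod v', prod_mem_class hiso hsum hQ hQ',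
      LinearMap.coprod_comp_prod _ _ _ _⟩

/-- If `M*` is a direct summand of a product of character modules of members of `B`, then every
linear map from a finitely presented module to `M` factors through a member of `B`. -/
lemma factorsThroughClass_of_isDirectSummand {R : Type u} [Ring R] {B : ModuleCat.{u} R → Prop}
    (hfp : ∀ N : ModuleCat.{u} R, B N → Module.FinitePresentation R (N : Type u))
    (hiso : ∀ (N N' : ModuleCat.{u} R), B N → ((N : Type u) ≃ₗ[R] (N' : Type u)) → B N')
    (hsum : ∀ (ι : Type u) [Fintype ι] (g : ι → ModuleCat.{u} R),
      (∀ i, B (g i)) → B (ModuleCat.of R (∀ i, (g i : Type u))))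
    {M : Type u} [AddCommGroup M] [Module R M]
    {ι : Type u} {G : ι → ModuleCat.{u} R} (hG : ∀ i, B (G i))
    (hM : IsDirectSummand Rᵐᵒᵖ (Character M) (∀ i, Character (G i : Type u)))
    {P : Type u} [AddCommGroup P] [Module R P] [Module.FinitePresentation R P] (h : P →ₗ[R] M) :
    FactorsThroughClass B h := by
  classical
  obtain ⟨i, π, hπ⟩ := hM
  by_contra hh
  let W := factorsThroughClassAddSubgroup B hiso hsum P M
  have hne : (QuotientAddGroup.mk h : (P →ₗ[R] M) ⧸ W) ≠ 0 := fun h0 =>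
    hh ((QuotientAddGroup.eq_zero_iff h).1 h0)
  obtain ⟨c, hc⟩ := CharacterModule.exists_character_apply_ne_zero_of_ne_zero hne
  let χ : (P →ₗ[R] M) →+ RatCircle :=
    AddMonoidHom.comp (show ((P →ₗ[R] M) ⧸ W) →+ RatCircle from c) (QuotientAddGroup.mk' W)
  have hχ : ∀ g, FactorsThroughClass B g → χ g = 0 := fun g hg => by
    have : (QuotientAddGroup.mk g : (P →ₗ[R] M) ⧸ W) = 0 := (QuotientAddGroup.eq_zero_iff g).2 hg
    exact (congrArg c this).trans (map_zero c)
  obtain ⟨n, p, hp⟩ := Module.Finite.exists_fin (R := R) (M := P)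
  obtain ⟨y, hy⟩ := exists_addMonoidHom_comp_eq
    ({ toFun := fun g k => g (p k), map_zero' := rfl, map_add' := fun _ _ => rfl } :
      (P →ₗ[R] M) →+ (Fin n → M)) χ fun g hg => by
    have : g = 0 := LinearMap.ext_on_range hp fun k => congrFun hg k
    rw [this, map_zero]
  let φ : Fin n → Character M := fun k => y.comp (AddMonoidHom.single (fun _ => M) k)
  have hφ : ∀ g, ∑ k, φ k (g (p k)) = χ g := fun g => by
    rw [← hy g]
    refine (map_sum y (fun k => Pi.single k (g (p k))) Finset.univ).symm.trans ?_
    rw [Finset.univ_sum_single]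
    rfl
  let e := characterDirectSumEquiv (R := R) (fun i => (G i : Type u))
  have key : ∀ u : P →ₗ[R] ⨁ i, (G i : Type u), ∑ k, e (i (φ k)) (u (p k)) = 0 := fun u => by
    have h₁ : ∀ j, ∑ k, i (φ k) j (u (p k) j) = 0 := fun j => by
      have := hfp _ (hG j)
      refine sum_apply_eq_zero_of_forall_linearMap φ (fun k => u (p k) j) (fun g => ?_)
        (LinearMap.proj j ∘ₗ i)
      exact (hφ (g ∘ₗ DirectSum.component R ι _ j ∘ₗ u)).trans
        (hχ _ ⟨G j, DirectSum.component R ι _ j ∘ₗ u, g, hG j, rfl⟩)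
    let T : Finset ι := Finset.univ.biUnion fun k => DFinsupp.support (u (p k))
    have h₂ : ∀ k, e (i (φ k)) (u (p k)) = ∑ j ∈ T, i (φ k) j (u (p k) j) := fun k => by
      refine (DFinsupp.sumAddHom_apply (fun j => (i (φ k) j : (G j : Type u) →+ RatCircle))
        (u (p k))).trans (Finset.sum_subset
          (Finset.subset_biUnion_of_mem (fun k => DFinsupp.support (u (p k))) (Finset.mem_univ k))
          fun j _ hj => ?_)
      rw [DFinsupp.notMem_support_iff.1 hj]
      exact map_zero (i (φ k) j)
    simp only [h₂]
    rw [Finset.sum_comm]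
    exact Finset.sum_eq_zero fun j _ => h₁ j
  have := sum_apply_eq_zero_of_forall_linearMap (fun k => e (i (φ k))) p key
    (Character.dual h ∘ₗ π ∘ₗ e.symm.toLinearMap)
  have hπφ : ∀ k, π (i (φ k)) = φ k := fun k => LinearMap.congr_fun hπ (φ k)
  simp only [LinearMap.comp_apply, LinearEquiv.coe_coe, LinearEquiv.symm_apply_apply, hπφ,
    Character.dual_apply, hφ] at this
  exact hc this

section FreeOn

variable {R : Type*} [Ring R] {α X : Type*} [AddCommGroup X] [Module R X]
  (b : Module.Basis α R X)

/-- The span of a finite set of basis vectors. -/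
def freeOn (S : Finset α) : Submodule R X :=
  Submodule.span R (b '' S)

lemma freeOn_mono {S T : Finset α} (h : S ⊆ T) : freeOn b S ≤ freeOn b T :=
  Submodule.span_mono (Set.image_mono (Finset.coe_subset.2 h))

lemma mem_freeOn {S : Finset α} {e : α} (h : e ∈ S) : b e ∈ freeOn b S :=
  Submodule.subset_span ⟨e, h, rfl⟩

instance (S : Finset α) : Module.Finite R (freeOn b S) :=
  Module.Finite.span_of_finite R (S.finite_toSet.image b)

instance (S : Finset α) : Module.Free R (freeOn b S) := by
  rw [freeOn, Set.image_eq_range]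
  exact Module.Free.of_basis (Module.Basis.span
    (b.linearIndependent.comp (fun e : (S : Set α) => (e : α)) Subtype.val_injective))

end FreeOn

section Lazard

variable {R : Type u} [Ring R] {M : Type u} [AddCommGroup M] [Module R M]
  {X : Type u} [AddCommGroup X] [Module R X] (b : Module.Basis (M × ℕ) R X)

/-- The canonical map onto `M` from the free module on countably many copies of `M`. -/
def freeCover : X →ₗ[R] M :=
  b.constr ℕ Prod.fst

/-- Finite sets of generators and of relations of `M` can be enlarged so that the resulting
finitely presented module lies in `B`. -/
lemma exists_enlarged_presentation {B : ModuleCat.{u} R → Prop}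
    (hfp : ∀ N : ModuleCat.{u} R, B N → Module.FinitePresentation R (N : Type u))
    (hiso : ∀ (N N' : ModuleCat.{u} R), B N → ((N : Type u) ≃ₗ[R] (N' : Type u)) → B N')
    (hM : ∀ (P : Type u) [AddCommGroup P] [Module R P] [Module.FinitePresentation R P]
      (h : P →ₗ[R] M), FactorsThroughClass B h)
    (S : Finset (M × ℕ)) (K : Submodule R X) (hKfg : K.FG)
    (hKS : K ≤ freeOn b S)
    (hK : K ≤ LinearMap.ker (freeCover b)) :
    ∃ (S' : Finset (M × ℕ)) (L : Submodule R X), S ⊆ S' ∧ K ≤ L ∧ L.FG ∧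
      L ≤ freeOn b S' ∧ L ≤ LinearMap.ker (freeCover b) ∧
      B (ModuleCat.of R (freeOn b S' ⧸
        L.comap (freeOn b S').subtype)) := by
  classical
  have map_comap_freeOn : ∀ (T : Finset (M × ℕ)) (L : Submodule R X),
      L ≤ freeOn b T →
      (L.comap (freeOn b T).subtype).map
        (freeOn b T).subtype = L := fun T L hL => by
    rw [Submodule.map_comap_subtype, inf_eq_right.2 hL]
  let XS := freeOn b S
  let K' : Submodule R XS := K.comap XS.subtype
  have hK'fg : K'.FG := by
    refine Submodule.fg_of_fg_map_injective XS.subtype XS.injective_subtype ?_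
    rwa [map_comap_freeOn S K hKS]
  have : Module.FinitePresentation R (XS ⧸ K') :=
    Module.finitePresentation_of_free_of_surjective K'.mkQ K'.mkQ_surjective
      (by rwa [Submodule.ker_mkQ])
  obtain ⟨Q, u, v, hQ, hvu⟩ := hM (XS ⧸ K') (K'.liftQ (freeCover b ∘ₗ XS.subtype)
    fun x hx => hK hx)
  have := hfp Q hQ
  obtain ⟨n, q, hq⟩ := Module.Finite.exists_fin (R := R) (M := Q)
  obtain ⟨a, ha⟩ : ∃ a : ℕ, ∀ e ∈ S, e.2 < a :=
    ⟨S.sup Prod.snd + 1, fun e he => Nat.lt_succ_of_le (Finset.le_sup (f := Prod.snd) he)⟩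
  let c : M × ℕ → Q := fun e =>
    if h : e ∈ S then u (K'.mkQ ⟨b e, mem_freeOn b h⟩)
    else if h : e.2 - a < n then q ⟨e.2 - a, h⟩ else 0
  let E : Fin n → M × ℕ := fun k => (v (q k), a + k)
  have hcE : ∀ k, c (E k) = q k := fun k => by
    have h₁ : E k ∉ S := fun h => by
      have := ha _ h
      simp [E] at this
    simp [c, h₁, E]
  let S' : Finset (M × ℕ) := S ∪ Finset.univ.image E
  have hES' : ∀ k, E k ∈ S' := fun k =>
    Finset.mem_union_right _ (Finset.mem_image_of_mem _ (Finset.mem_univ k))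
  let XS' := freeOn b S'
  let w : X →ₗ[R] Q := b.constr ℕ c
  have hwS : ∀ x (hx : x ∈ XS), w x = u (K'.mkQ ⟨x, hx⟩) := fun x hx => by
    induction hx using Submodule.span_induction with
    | mem x hx =>
      obtain ⟨e, he, rfl⟩ := hx
      have he : e ∈ S := he
      simp [w, c, he]
    | zero => exact (map_zero w).trans (map_zero (u ∘ₗ K'.mkQ)).symm
    | add x y hx hy ihx ihy =>
      rw [map_add, ihx, ihy]
      exact (map_add (u ∘ₗ K'.mkQ) ⟨x, hx⟩ ⟨y, hy⟩).symm
    | smul r x hx ih =>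
      rw [map_smul, ih]
      exact (map_smul (u ∘ₗ K'.mkQ) r ⟨x, hx⟩).symm
  have hvw : ∀ x ∈ XS', v (w x) = freeCover b x := by
    refine LinearMap.eqOn_span (f := v ∘ₗ w) ?_
    rintro _ ⟨e, he, rfl⟩
    rcases Finset.mem_union.1 (Finset.mem_coe.1 he) with he | he
    · rw [LinearMap.comp_apply, hwS _ (mem_freeOn b he)]
      exact LinearMap.congr_fun hvu (K'.mkQ ⟨b e, mem_freeOn b he⟩)
    · obtain ⟨k, -, rfl⟩ := Finset.mem_image.1 he
      simp [w, hcE, freeCover, E]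
  let w' : XS' →ₗ[R] Q := w ∘ₗ XS'.subtype
  have hw' : Function.Surjective w' := by
    rw [← LinearMap.range_eq_top, ← top_le_iff, ← hq, Submodule.span_le]
    rintro _ ⟨k, rfl⟩
    exact ⟨⟨b (E k), mem_freeOn b (hES' k)⟩, by
      simp [w', w, hcE]⟩
  have hker : (XS' ⊓ LinearMap.ker w).comap XS'.subtype = LinearMap.ker w' := by
    ext x
    simp [w']
  refine ⟨S', XS' ⊓ LinearMap.ker w, Finset.subset_union_left, fun x hx => ⟨?_, ?_⟩, ?_,
    inf_le_left, fun x hx => ?_, ?_⟩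
  · exact freeOn_mono b Finset.subset_union_left (hKS hx)
  · have h₁ : K'.mkQ ⟨x, hKS hx⟩ = 0 := (Submodule.Quotient.mk_eq_zero _).2 hx
    change w x = 0
    rw [hwS x (hKS hx), h₁, map_zero]
  · rw [← map_comap_freeOn S' _ inf_le_left, hker]
    exact (Module.FinitePresentation.fg_ker w' hw').map _
  · rw [LinearMap.mem_ker, ← hvw x hx.1, LinearMap.mem_ker.1 hx.2, map_zero]
  · rw [hker]
    exact hiso Q _ hQ (w'.quotKerEquivOfSurjective hw').symm

/-- A finite set of generators of `M` together with finitely many relations between them,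
presenting a member of the class `B`. -/
structure PresentationStage (B : ModuleCat.{u} R → Prop) (b : Module.Basis (M × ℕ) R X) :
    Type u where
  gens : Finset (M × ℕ)
  rels : Submodule R X
  fg : rels.FG
  le_freeOn : rels ≤ freeOn b gens
  le_ker : rels ≤ LinearMap.ker (freeCover b)
  mem : B (ModuleCat.of R (freeOn b gens ⧸
    rels.comap (freeOn b gens).subtype))

namespace PresentationStage

variable {B : ModuleCat.{u} R → Prop} {b : Module.Basis (M × ℕ) R X}

instance : Preorder (PresentationStage B b) :=
  Preorder.lift fun i => (i.gens, i.rels)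

/-- The module presented by a stage. -/
abbrev Obj (i : PresentationStage B b) : Type u :=
  freeOn b i.gens ⧸
    i.rels.comap (freeOn b i.gens).subtype

lemma freeOn_le {i j : PresentationStage B b} (h : i ≤ j) :
    freeOn b i.gens ≤ freeOn b j.gens :=
  freeOn_mono b h.1

/-- The transition maps between stages. -/
def map (i j : PresentationStage B b) (h : i ≤ j) : i.Obj →ₗ[R] j.Obj :=
  Submodule.mapQ _ _ (Submodule.inclusion (freeOn_le h)) fun _ hx => h.2 hx

instance : DirectedSystem (fun i : PresentationStage B b => i.Obj) (fun i j h => map i j h) where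
  map_self i x := by
    obtain ⟨x, rfl⟩ := Submodule.mkQ_surjective _ x
    rfl
  map_map i j k hij hjk x := by
    obtain ⟨x, rfl⟩ := Submodule.mkQ_surjective _ x
    rfl

/-- The canonical map from a stage to `M`. -/
def toModule (i : PresentationStage B b) : i.Obj →ₗ[R] M :=
  Submodule.liftQ _ (freeCover b ∘ₗ (freeOn b i.gens).subtype)
    fun _ hx => i.le_ker hx

lemma toModule_map (i j : PresentationStage B b) (h : i ≤ j) (x : i.Obj) :
    j.toModule (map i j h x) = i.toModule x := by
  obtain ⟨x, rfl⟩ := Submodule.mkQ_surjective _ x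
  rfl

end PresentationStage

/-- If every linear map from a finitely presented module to `M` factors through a member of `B`,
then `M` is a directed colimit of members of `B`. -/
lemma nonempty_directedColimitPresentation {B : ModuleCat.{u} R → Prop}
    (hfp : ∀ N : ModuleCat.{u} R, B N → Module.FinitePresentation R (N : Type u))
    (hiso : ∀ (N N' : ModuleCat.{u} R), B N → ((N : Type u) ≃ₗ[R] (N' : Type u)) → B N')
    (hM : ∀ (P : Type u) [AddCommGroup P] [Module R P] [Module.FinitePresentation R P]
      (h : P →ₗ[R] M), FactorsThroughClass B h) :
    Nonempty (DirectedColimitPresentation R B M) := by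
  classical
  let b : Module.Basis (M × ℕ) R (M × ℕ →₀ R) := Finsupp.basisSingleOne
  have exists_stage : ∀ (S : Finset (M × ℕ)) (K : Submodule R (M × ℕ →₀ R)), K.FG →
      K ≤ freeOn b S → K ≤ LinearMap.ker (freeCover b) →
      ∃ i : PresentationStage B b, S ⊆ i.gens ∧ K ≤ i.rels := fun S K h₁ h₂ h₃ => by
    obtain ⟨S', L, hS, hKL, hfg, hs, hk, hB⟩ :=
      exists_enlarged_presentation b hfp hiso hM S K h₁ h₂ h₃
    exact ⟨⟨S', L, hfg, hs, hk, hB⟩, hS, hKL⟩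
  have hdir : IsDirected (PresentationStage B b) (· ≤ ·) := ⟨fun i j => by
    obtain ⟨k, hS, hK⟩ := exists_stage (i.gens ∪ j.gens) (i.rels ⊔ j.rels) (i.fg.sup j.fg)
      (sup_le
        (i.le_freeOn.trans (freeOn_mono b Finset.subset_union_left))
        (j.le_freeOn.trans (freeOn_mono b Finset.subset_union_right)))
      (sup_le i.le_ker j.le_ker)
    exact ⟨k, ⟨Finset.subset_union_left.trans hS, le_sup_left.trans hK⟩,
      ⟨Finset.subset_union_right.trans hS, le_sup_right.trans hK⟩⟩⟩
  have hne : Nonempty (PresentationStage B b) := by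
    obtain ⟨i, -⟩ := exists_stage ∅ ⊥ Submodule.fg_bot bot_le bot_le
    exact ⟨i⟩
  let F : Module.DirectLimit (fun i : PresentationStage B b => i.Obj)
      (fun i j h => PresentationStage.map i j h) →ₗ[R] M :=
    Module.DirectLimit.lift R _ _ _ (fun i => i.toModule) PresentationStage.toModule_map
  have hinj : Function.Injective F := by
    intro z z' hz
    obtain ⟨i, x, y, rfl, rfl⟩ := Module.DirectLimit.exists_of₂ z z'
    obtain ⟨⟨x, hx⟩, rfl⟩ := Submodule.mkQ_surjective _ x
    obtain ⟨⟨y, hy⟩, rfl⟩ := Submodule.mkQ_surjective _ y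
    have hxy : freeCover b (x - y) = 0 := by
      rw [Module.DirectLimit.lift_of, Module.DirectLimit.lift_of] at hz
      rw [map_sub]
      exact sub_eq_zero.2 hz
    obtain ⟨j, hS, hK⟩ := exists_stage i.gens (i.rels ⊔ Submodule.span R {x - y})
      (i.fg.sup (Submodule.fg_span_singleton (x - y)))
      (sup_le i.le_freeOn ((Submodule.span_singleton_le_iff_mem _ _).2 (sub_mem hx hy)))
      (sup_le i.le_ker ((Submodule.span_singleton_le_iff_mem _ _).2 hxy))
    have hij : i ≤ j := ⟨hS, le_sup_left.trans hK⟩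
    refine (Module.DirectLimit.of_f (hij := hij)).symm.trans
      ((congrArg _ ?_).trans (Module.DirectLimit.of_f (hij := hij)))
    refine (Submodule.Quotient.eq _).2 ?_
    exact hK (Submodule.mem_sup_right (Submodule.mem_span_singleton_self (x - y)))
  have hsurj : Function.Surjective F := fun m => by
    obtain ⟨i, hS, -⟩ := exists_stage {(m, 0)} ⊥ Submodule.fg_bot bot_le bot_le
    have hm : b (m, 0) ∈ freeOn b i.gens := mem_freeOn b (hS (Finset.mem_singleton_self _))
    refine ⟨Module.DirectLimit.of R _ _ _ i (Submodule.Quotient.mk ⟨_, hm⟩), ?_⟩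
    rw [Module.DirectLimit.lift_of]
    change freeCover b (b (m, 0)) = m
    simp [freeCover]
  exact ⟨{
    ι := PresentationStage B b
    directed := hdir
    nonempty := hne
    G := fun i => i.Obj
    mem := fun i => i.mem
    f := PresentationStage.map
    dirsys := inferInstance
    equiv := (LinearEquiv.ofBijective F ⟨hinj, hsurj⟩).symm }⟩

end Lazard

theorem holm_direct_limit_closure_iff_dual_in_Prod
    {R : Type u} [Ring R] (B : ModuleCat.{u} R → Prop)
    (hfp : ∀ N : ModuleCat.{u} R, B N → Module.FinitePresentation R (N : Type u))
    (hiso : ∀ (N N' : ModuleCat.{u} R), B N → ((N : Type u) ≃ₗ[R] (N' : Type u)) → B N')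
    (hsum : ∀ (ι : Type u) [Fintype ι] (g : ι → ModuleCat.{u} R),
      (∀ i, B (g i)) → B (ModuleCat.of R (∀ i, (g i : Type u))))
    (hsummand : ∀ (N N' : ModuleCat.{u} R), B N' →
      IsDirectSummand R (N : Type u) (N' : Type u) → B N)
    (M : Type u) [AddCommGroup M] [Module R M] :
    Nonempty (DirectedColimitPresentation R B M) ↔
      ∃ (ι : Type u) (g : ι → ModuleCat.{u} R), (∀ i, B (g i)) ∧
        IsDirectSummand Rᵐᵒᵖ (Character M) (∀ i, Character (g i : Type u)) := by
  constructor
  · rintro ⟨D⟩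
    let := D.pre
    let := D.dec
    let := D.acg
    let := D.mod
    have := D.directed
    have := D.nonempty
    have := D.dirsys
    exact ⟨D.ι, fun i => ModuleCat.of R (D.G i), D.mem,
      isDirectSummand_character_directLimit D.G D.f M D.equiv⟩
  · rintro ⟨ι, G, hG, hM⟩
    exact nonempty_directedColimitPresentation hfp hiso fun P _ _ _ h =>
      factorsThroughClass_of_isDirectSummand hfp hiso hsum hG hM h

end
end
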